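/- arXiv:math/0506411 — 3 statements merged into one kernel-verified Lean document; each statement's English description precedes it below -/
import Mathlib

section
/- Let v : ℝ × ℝ → ℝ (variables (t,x)) be measurable with: ess sup_{t ∈ ℝ} ‖v(t, ·)‖_{L²(ℝ)} < ∞; v ∈ L²_loc(ℝ²); v possesses a weak derivative ∂_x v ∈ L²_loc(ℝ²); and v is a weak solution of the modified Korteweg–de Vries equation, i.e. ∫∫_{ℝ²} (−v φ_t − v φ_{xxx} + 2v³ φ_x) dt dx = 0 for every φ ∈ C_c^∞(ℝ²; ℝ) (note v ∈ L⁶_loc(ℝ²) under the above hypotheses, so v³ is locally integrable). Then the function u := ∂_x v + v², which belongs to L²_loc(ℝ²), is a weak solution of the Korteweg–de Vries equation: ∫∫_{ℝ²} (−u φ_t − u φ_{xxx} + 3u² φ_x) dt dx = 0 for every φ ∈ C_c^∞(ℝ²; ℝ). -/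
open MeasureTheory Filter Set intervalIntegral ENNReal

/-- Partial derivative in the time variable `t` (first coordinate) of a test function. -/
noncomputable def Dt (φ : ℝ × ℝ → ℝ) : ℝ × ℝ → ℝ := fun p => fderiv ℝ φ p (1, 0)

/-- Partial derivative in the space variable `x` (second coordinate) of a test function. -/
noncomputable def Dx (φ : ℝ × ℝ → ℝ) : ℝ × ℝ → ℝ := fun p => fderiv ℝ φ p (0, 1)

/-- Convolution of `f` with the kernel `k` on the plane. -/
noncomputable def planeConv (k f : ℝ × ℝ → ℝ) : ℝ × ℝ → ℝ := fun p => ∫ q, k (p - q) * f q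

/-- Smooth functions with compact support. -/
structure IsTest (φ : ℝ × ℝ → ℝ) : Prop where
  smooth : ContDiff ℝ (⊤ : ℕ∞) φ
  compact : HasCompactSupport φ

lemma planeConv_eq_convolution (k f : ℝ × ℝ → ℝ) :
    planeConv k f = convolution k f (ContinuousLinearMap.lsmul ℝ ℝ) volume := by
  funext p
  rw [convolution_lsmul_swap]
  rfl

lemma contDiff_fderiv_apply {f : ℝ × ℝ → ℝ} (hf : ContDiff ℝ (⊤ : ℕ∞) f) (e : ℝ × ℝ) :
    ContDiff ℝ (⊤ : ℕ∞) (fun p => fderiv ℝ f p e) :=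
  (hf.fderiv_right (m := ((⊤ : ℕ∞) : WithTop ℕ∞)) (by simp)).clm_apply contDiff_const

lemma contDiff_Dx {f : ℝ × ℝ → ℝ} (hf : ContDiff ℝ (⊤ : ℕ∞) f) :
    ContDiff ℝ (⊤ : ℕ∞) (Dx f) := contDiff_fderiv_apply hf _

namespace IsTest

variable {k φ f : ℝ × ℝ → ℝ}

lemma continuous (hφ : IsTest φ) : Continuous φ := hφ.smooth.continuous

lemma fderiv_apply (hφ : IsTest φ) (e : ℝ × ℝ) : IsTest (fun p => fderiv ℝ φ p e) :=
  ⟨contDiff_fderiv_apply hφ.smooth e, hφ.compact.fderiv_apply ℝ e⟩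

lemma dx (hφ : IsTest φ) : IsTest (Dx φ) := hφ.fderiv_apply _

lemma dt (hφ : IsTest φ) : IsTest (Dt φ) := hφ.fderiv_apply _

lemma mul_left (hφ : IsTest φ) (hf : ContDiff ℝ (⊤ : ℕ∞) f) : IsTest (fun p => f p * φ p) :=
  ⟨hf.mul hφ.smooth, hφ.compact.mul_left⟩

lemma integrable (hφ : IsTest φ) : Integrable φ :=
  hφ.continuous.integrable_of_hasCompactSupport hφ.compact

lemma integral_fderiv_apply (hφ : IsTest φ) (e : ℝ × ℝ) : ∫ p, fderiv ℝ φ p e = 0 := by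
  have h := integral_mul_fderiv_eq_neg_fderiv_mul_of_integrable (μ := volume) (𝕜 := ℝ)
    (f := fun _ : ℝ × ℝ => (1 : ℝ)) (g := φ) (v := e) (by simp)
    (by simpa using (hφ.fderiv_apply e).integrable) (by simpa using hφ.integrable)
    (fun _ _ => by fun_prop) (fun x _ => (hφ.smooth.differentiable (by simp)) x)
  simpa using h

lemma integral_dx (hφ : IsTest φ) : ∫ p, Dx φ p = 0 := hφ.integral_fderiv_apply _

lemma integral_dt (hφ : IsTest φ) : ∫ p, Dt φ p = 0 := hφ.integral_fderiv_apply _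

lemma reflect (hk : IsTest k) (p : ℝ × ℝ) : IsTest (fun q => k (p - q)) :=
  ⟨hk.smooth.comp (contDiff_const.sub contDiff_id),
    hk.compact.comp_homeomorph (Homeomorph.subLeft p)⟩

lemma fderiv_reflect (hk : IsTest k) (e p q : ℝ × ℝ) :
    fderiv ℝ (fun q => k (p - q)) q e = - fderiv ℝ k (p - q) e := by
  have h1 : HasFDerivAt k (fderiv ℝ k (p - q)) (p - q) :=
    (hk.smooth.differentiable (by simp) _).hasFDerivAt
  have h2 : HasFDerivAt (fun q : ℝ × ℝ => p - q) (-ContinuousLinearMap.id ℝ (ℝ × ℝ)) q :=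
    (hasFDerivAt_id q).const_sub p
  have := (h1.comp q h2).fderiv
  change fderiv ℝ (k ∘ fun q => p - q) q e = _
  rw [this]
  simp

lemma dx_reflect (hk : IsTest k) (p : ℝ × ℝ) :
    Dx (fun q => k (p - q)) = fun q => - Dx k (p - q) :=
  funext fun q => hk.fderiv_reflect _ p q

lemma dt_reflect (hk : IsTest k) (p : ℝ × ℝ) :
    Dt (fun q => k (p - q)) = fun q => - Dt k (p - q) :=
  funext fun q => hk.fderiv_reflect _ p q

lemma dx_dx_dx_reflect (hk : IsTest k) (p : ℝ × ℝ) :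
    Dx (Dx (Dx (fun q => k (p - q)))) = fun q => - Dx (Dx (Dx k)) (p - q) := by
  have neg (g : ℝ × ℝ → ℝ) : Dx (fun q => - g q) = fun q => - Dx g q := by
    funext q; simp [Dx]
  rw [hk.dx_reflect, neg, hk.dx.dx_reflect, neg, neg, hk.dx.dx.dx_reflect]
  simp

lemma integrable_mul (hφ : IsTest φ) (hf : LocallyIntegrable f) :
    Integrable (fun p => φ p * f p) :=
  hf.integrable_smul_left_of_hasCompactSupport hφ.continuous hφ.compact

lemma contDiff_planeConv (hk : IsTest k) (hf : LocallyIntegrable f) :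
    ContDiff ℝ (⊤ : ℕ∞) (planeConv k f) := by
  rw [planeConv_eq_convolution]
  exact hk.compact.contDiff_convolution_left _ hk.smooth hf

lemma fderiv_planeConv (hk : IsTest k) (hf : LocallyIntegrable f) (e p : ℝ × ℝ) :
    fderiv ℝ (planeConv k f) p e = planeConv (fun q => fderiv ℝ k q e) f p := by
  have h := hk.compact.hasFDerivAt_convolution_left (ContinuousLinearMap.lsmul ℝ ℝ)
    (hk.smooth.of_le (by simp)) hf p
  rw [planeConv_eq_convolution, planeConv_eq_convolution, h.fderiv, convolution, convolution,
    ContinuousLinearMap.integral_apply]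
  · rfl
  · exact (hk.compact.fderiv ℝ).convolutionExists_left _
      (hk.smooth.continuous_fderiv (by simp)) hf p

lemma dx_planeConv (hk : IsTest k) (hf : LocallyIntegrable f) :
    Dx (planeConv k f) = planeConv (Dx k) f := funext fun p => hk.fderiv_planeConv hf _ p

lemma dt_planeConv (hk : IsTest k) (hf : LocallyIntegrable f) :
    Dt (planeConv k f) = planeConv (Dt k) f := funext fun p => hk.fderiv_planeConv hf _ p

end IsTest

/-- Leibniz rule in the `x` direction. -/
lemma Dx_mul {f g : ℝ × ℝ → ℝ} (hf : ContDiff ℝ (⊤ : ℕ∞) f) (hg : ContDiff ℝ (⊤ : ℕ∞) g) :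
    Dx (fun p => f p * g p) = fun p => Dx f p * g p + f p * Dx g p := by
  funext p
  have := fderiv_mul (hf.differentiable (by simp) p) (hg.differentiable (by simp) p)
  simp only [Dx]
  erw [this]
  simp
  ring

/-- Leibniz rule in the `t` direction. -/
lemma Dt_mul {f g : ℝ × ℝ → ℝ} (hf : ContDiff ℝ (⊤ : ℕ∞) f) (hg : ContDiff ℝ (⊤ : ℕ∞) g) :
    Dt (fun p => f p * g p) = fun p => Dt f p * g p + f p * Dt g p := by
  funext p
  have := fderiv_mul (hf.differentiable (by simp) p) (hg.differentiable (by simp) p)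
  simp only [Dt]
  erw [this]
  simp
  ring

lemma Dx_pow {f : ℝ × ℝ → ℝ} (hf : ContDiff ℝ (⊤ : ℕ∞) f) (n : ℕ) :
    Dx (fun p => f p ^ n) = fun p => n * f p ^ (n - 1) * Dx f p := by
  funext p
  have := fderiv_pow (𝕜 := ℝ) n (hf.differentiable (by simp) p)
  simp only [Dx]
  erw [this]
  simp

lemma Dt_pow {f : ℝ × ℝ → ℝ} (hf : ContDiff ℝ (⊤ : ℕ∞) f) (n : ℕ) :
    Dt (fun p => f p ^ n) = fun p => n * f p ^ (n - 1) * Dt f p := by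
  funext p
  have := fderiv_pow (𝕜 := ℝ) n (hf.differentiable (by simp) p)
  simp only [Dt]
  erw [this]
  simp

/-- Integration by parts in `x` against a power of a smooth function. -/
lemma integral_pow_mul_dx {V φ : ℝ × ℝ → ℝ} (hV : ContDiff ℝ (⊤ : ℕ∞) V)
    (hφ : IsTest φ) (n : ℕ) :
    (∫ p, V p ^ n * Dx φ p) + n * ∫ p, V p ^ (n - 1) * Dx V p * φ p = 0 := by
  have h := (hφ.mul_left (hV.pow n)).integral_dx
  rw [Dx_mul (hV.pow n) hφ.smooth, Dx_pow hV,
    MeasureTheory.integral_add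
      ((hφ.mul_left ((contDiff_const.mul (hV.pow _)).mul (contDiff_Dx hV))).integrable)
      (hφ.dx.mul_left (hV.pow n)).integrable] at h
  rw [← MeasureTheory.integral_const_mul, ← h, add_comm]
  congr 1
  congr 1
  funext p
  ring

/-- The local conservation law of `V²` for smooth solutions of `V_t + V_xxx = 2 C_x`. -/
lemma integral_sq_conservation_of_smooth {V C φ : ℝ × ℝ → ℝ} (hV : ContDiff ℝ (⊤ : ℕ∞) V)
    (hC : ContDiff ℝ (⊤ : ℕ∞) C) (hφ : IsTest φ)
    (heq : ∀ p, Dt V p + Dx (Dx (Dx V)) p = 2 * Dx C p) :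
    ∫ p, (- V p ^ 2 * Dt φ p - V p ^ 2 * Dx (Dx (Dx φ)) p + 3 * Dx V p ^ 2 * Dx φ p
      + 4 * (C p * Dx V p * φ p + C p * V p * Dx φ p)) = 0 := by
  have hV1 := contDiff_Dx hV
  have hV2 := contDiff_Dx hV1
  have d1 := Dt_mul (hV.pow 2) hφ.smooth
  have d2 := Dx_mul (hV.mul hV2) hφ.smooth
  have d3 := Dx_mul (hV1.pow 2) hφ.smooth
  have d4 := Dx_mul (hV.mul hV1) hφ.dx.smooth
  have d5 := Dx_mul (hV.pow 2) hφ.dx.dx.smooth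
  have d6 := Dx_mul (hV.mul hC) hφ.smooth
  have i1 := hφ.mul_left (hV.pow 2)
  have i2 := hφ.mul_left (hV.mul hV2)
  have i3 := hφ.mul_left (hV1.pow 2)
  have i4 := hφ.dx.mul_left (hV.mul hV1)
  have i5 := hφ.dx.dx.mul_left (hV.pow 2)
  have i6 := hφ.mul_left (hV.mul hC)
  rw [Dt_pow hV] at d1
  rw [Dx_mul hV hV2] at d2
  rw [Dx_pow hV1] at d3
  rw [Dx_mul hV hV1] at d4
  rw [Dx_pow hV] at d5
  rw [Dx_mul hV hC] at d6
  calc _ = ∫ p, (-(Dt (fun p => V p ^ 2 * φ p) p) - 2 * Dx (fun p => V p * Dx (Dx V) p * φ p) p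
        + Dx (fun p => Dx V p ^ 2 * φ p) p + 2 * Dx (fun p => V p * Dx V p * Dx φ p) p
        - Dx (fun p => V p ^ 2 * Dx (Dx φ) p) p + 4 * Dx (fun p => V p * C p * φ p) p) := by
        congr 1
        funext p
        rw [d1, d2, d3, d4, d5, d6]
        have := heq p
        push_cast
        linear_combination (- 2 * V p * φ p) * this * (-1)
    _ = 0 := by
        have e1 := i1.dt.integrable
        have e2 := i2.dx.integrable
        have e3 := i3.dx.integrable
        have e4 := i4.dx.integrable
        have e5 := i5.dx.integrable
        have e6 := i6.dx.integrable
        rw [MeasureTheory.integral_add, MeasureTheory.integral_sub, MeasureTheory.integral_add,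
          MeasureTheory.integral_add, MeasureTheory.integral_sub, MeasureTheory.integral_neg,
          MeasureTheory.integral_const_mul, MeasureTheory.integral_const_mul,
          MeasureTheory.integral_const_mul, i1.integral_dt,
          i2.integral_dx, i3.integral_dx, i4.integral_dx, i5.integral_dx, i6.integral_dx]
        · simp
        all_goals fun_prop

/-- A sequence of bump functions shrinking to the origin. -/
noncomputable def shrinkingBump (n : ℕ) : ContDiffBump (0 : ℝ × ℝ) where
  rIn := 1 / (n + 1)
  rOut := 2 / (n + 1)
  rIn_pos := by positivity
  rIn_lt_rOut := by gcongr; norm_num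

/-- A sequence of standard mollifiers on the plane. -/
noncomputable def mollifier (n : ℕ) : ℝ × ℝ → ℝ := (shrinkingBump n).normed volume

lemma isTest_mollifier (n : ℕ) : IsTest (mollifier n) :=
  ⟨(shrinkingBump n).contDiff_normed, (shrinkingBump n).hasCompactSupport_normed⟩

lemma mollifier_nonneg (n : ℕ) (p : ℝ × ℝ) : 0 ≤ mollifier n p :=
  (shrinkingBump n).nonneg_normed p

lemma mollifier_sub_comm (n : ℕ) (p q : ℝ × ℝ) : mollifier n (p - q) = mollifier n (q - p) := by
  rw [← neg_sub]
  exact (shrinkingBump n).normed_neg _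

lemma integral_mollifier (n : ℕ) : ∫ q, mollifier n q = 1 := (shrinkingBump n).integral_normed

lemma integral_mollifier_sub (n : ℕ) (p : ℝ × ℝ) : ∫ q, mollifier n (p - q) = 1 := by
  rw [integral_sub_left_eq_self (mollifier n) volume p, integral_mollifier]

lemma mollifier_eq_zero {n : ℕ} {p : ℝ × ℝ} (hp : 2 ≤ ‖p‖) : mollifier n p = 0 := by
  by_contra h
  have h1 : p ∈ Function.support (mollifier n) := h
  rw [mollifier, (shrinkingBump n).support_normed_eq, mem_ball_zero_iff] at h1
  have h2 : (shrinkingBump n).rOut ≤ 2 := div_le_self (by norm_num) (by simp)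
  linarith

lemma tendsto_shrinkingBump_rOut :
    Tendsto (fun n => (shrinkingBump n).rOut) atTop (nhds 0) := by
  have h := (tendsto_one_div_add_atTop_nhds_zero_nat (𝕜 := ℝ)).const_mul 2
  simpa [shrinkingBump, div_eq_mul_inv] using h

lemma ae_tendsto_planeConv_mollifier {f : ℝ × ℝ → ℝ} (hf : LocallyIntegrable f) :
    ∀ᵐ p, Tendsto (fun n => planeConv (mollifier n) f p) atTop (nhds (f p)) := by
  simp only [planeConv_eq_convolution]
  refine ContDiffBump.ae_convolution_tendsto_right_of_locallyIntegrable (K := 2)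
    tendsto_shrinkingBump_rOut (Eventually.of_forall fun n => le_of_eq ?_) hf
  simp [shrinkingBump, div_eq_mul_inv]

lemma tendsto_planeConv_mollifier_of_continuous {f : ℝ × ℝ → ℝ} (hf : Continuous f) (p : ℝ × ℝ) :
    Tendsto (fun n => planeConv (mollifier n) f p) atTop (nhds (f p)) := by
  simp only [planeConv_eq_convolution]
  exact ContDiffBump.convolution_tendsto_right_of_continuous tendsto_shrinkingBump_rOut hf p

/-- Jensen's inequality for mollification; convexity is expressed through tangent lines. -/
lemma jensen_planeConv (n : ℕ) {f : ℝ × ℝ → ℝ} {g g' : ℝ → ℝ} (hf : LocallyIntegrable f)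
    (hgf : LocallyIntegrable (fun p => g (f p)))
    (hg : ∀ a b, g b + g' b * (a - b) ≤ g a) (p : ℝ × ℝ) :
    g (planeConv (mollifier n) f p) ≤ planeConv (mollifier n) (fun p => g (f p)) p := by
  have hk := (isTest_mollifier n).reflect p
  set b := planeConv (mollifier n) f p with hb
  have i1 := hk.integrable_mul hf
  have i2 := hk.integrable_mul hgf
  have i3 := hk.integrable
  calc g b = ∫ q, (mollifier n (p - q) * (g b - g' b * b)
        + g' b * (mollifier n (p - q) * f q)) := by
        rw [MeasureTheory.integral_add (i3.mul_const _) (i1.const_mul _),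
          MeasureTheory.integral_mul_const, MeasureTheory.integral_const_mul,
          integral_mollifier_sub]
        change _ = _ + g' b * b
        ring
    _ ≤ ∫ q, mollifier n (p - q) * g (f q) := by
        refine integral_mono ((i3.mul_const _).add (i1.const_mul _)) i2 fun q => ?_
        have := mul_le_mul_of_nonneg_left (hg (f q) b) (mollifier_nonneg n (p - q))
        simp only
        linarith

lemma sq_planeConv_le (n : ℕ) {f : ℝ × ℝ → ℝ} (hf : LocallyIntegrable f)
    (hf2 : LocallyIntegrable (fun p => f p ^ 2)) (p : ℝ × ℝ) :
    planeConv (mollifier n) f p ^ 2 ≤ planeConv (mollifier n) (fun p => f p ^ 2) p :=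
  jensen_planeConv n (g := fun a => a ^ 2) (g' := fun b => 2 * b) hf hf2
    (fun a b => by nlinarith [sq_nonneg (a - b)]) p

lemma pow_six_planeConv_le (n : ℕ) {f : ℝ × ℝ → ℝ} (hf : LocallyIntegrable f)
    (hf6 : LocallyIntegrable (fun p => f p ^ 6)) (p : ℝ × ℝ) :
    planeConv (mollifier n) f p ^ 6 ≤ planeConv (mollifier n) (fun p => f p ^ 6) p :=
  jensen_planeConv n (g := fun a => a ^ 6) (g' := fun b => 6 * b ^ 5) hf hf6
    (fun a b => by
      have h : a ^ 6 - b ^ 6 - 6 * b ^ 5 * (a - b)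
        = (a - b) ^ 2 * ((a ^ 2 + a * b) ^ 2 + 2 * (b * (a + b)) ^ 2 + 3 * b ^ 4) := by ring
      nlinarith [show 0 ≤ (a - b) ^ 2 * ((a ^ 2 + a * b) ^ 2 + 2 * (b * (a + b)) ^ 2 + 3 * b ^ 4)
        by positivity]) p

/-- Mollification is symmetric. -/
lemma integral_planeConv_mul (n : ℕ) {G ψ : ℝ × ℝ → ℝ} (hG : LocallyIntegrable G)
    (hψ : Continuous ψ) (hψc : HasCompactSupport ψ) :
    ∫ p, planeConv (mollifier n) G p * ψ p = ∫ q, G q * planeConv (mollifier n) ψ q := by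
  obtain ⟨C, hC⟩ := (isTest_mollifier n).compact.exists_bound_of_continuous
    (isTest_mollifier n).continuous
  set K : Set (ℝ × ℝ) := (fun z : (ℝ × ℝ) × (ℝ × ℝ) => z.1 - z.2) ''
    (tsupport ψ ×ˢ tsupport (mollifier n)) with hK
  have hKc : IsCompact K :=
    (hψc.isCompact.prod (isTest_mollifier n).compact.isCompact).image (by fun_prop)
  have hGK : Integrable (K.indicator G) :=
    (hG.integrableOn_isCompact hKc).integrable_indicator hKc.measurableSet
  have hdom : Integrable (fun z : (ℝ × ℝ) × (ℝ × ℝ) => C * (ψ z.1 * K.indicator G z.2))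
      (volume.prod volume) :=
    ((hψ.integrable_of_hasCompactSupport hψc).mul_prod hGK).const_mul C
  have hint : Integrable (Function.uncurry fun p q => mollifier n (p - q) * G q * ψ p)
      (volume.prod volume) := by
    refine hdom.mono ?_ (Eventually.of_forall ?_)
    · refine AEStronglyMeasurable.mul (AEStronglyMeasurable.mul ?_ ?_) ?_
      · exact ((isTest_mollifier n).continuous.comp
          (continuous_fst.sub continuous_snd)).aestronglyMeasurable
      · exact hG.aestronglyMeasurable.comp_snd
      · exact (hψ.comp continuous_fst).aestronglyMeasurable
    · rintro ⟨p, q⟩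
      simp only [Function.uncurry_apply_pair]
      by_cases h : mollifier n (p - q) * ψ p = 0
      · rw [mul_right_comm, h, zero_mul, norm_zero]
        exact norm_nonneg _
      · have hq : q ∈ K := ⟨(p, p - q), ⟨subset_tsupport _ (right_ne_zero_of_mul h),
          subset_tsupport _ (left_ne_zero_of_mul h)⟩, by simp⟩
        rw [indicator_of_mem hq, mul_assoc, mul_comm (G q), norm_mul, norm_mul C]
        gcongr
        exact (hC _).trans (le_abs_self C)
  calc _ = ∫ p, ∫ q, mollifier n (p - q) * G q * ψ p := by
        simp only [planeConv, MeasureTheory.integral_mul_const]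
    _ = ∫ q, ∫ p, mollifier n (p - q) * G q * ψ p := integral_integral_swap hint
    _ = _ := by
        congr 1
        funext q
        rw [planeConv, ← MeasureTheory.integral_const_mul]
        congr 1
        funext p
        rw [mollifier_sub_comm]
        ring

/-- Mollifications converge weakly. -/
lemma tendsto_integral_planeConv_mul {G ψ : ℝ × ℝ → ℝ} (hG : LocallyIntegrable G)
    (hψ : Continuous ψ) (hψc : HasCompactSupport ψ) :
    Tendsto (fun n => ∫ p, planeConv (mollifier n) G p * ψ p) atTop (nhds (∫ p, G p * ψ p)) := by
  obtain ⟨C, hC⟩ := hψc.exists_bound_of_continuous hψ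
  have hψL : LocallyIntegrable ψ := hψ.locallyIntegrable
  set K : Set (ℝ × ℝ) := (fun z : (ℝ × ℝ) × (ℝ × ℝ) => z.1 + z.2) ''
    (tsupport ψ ×ˢ Metric.closedBall 0 2) with hK
  have hKc : IsCompact K :=
    (hψc.isCompact.prod (isCompact_closedBall _ _)).image (by fun_prop)
  have hGK : Integrable (K.indicator G) :=
    (hG.integrableOn_isCompact hKc).integrable_indicator hKc.measurableSet
  simp only [integral_planeConv_mul _ hG hψ hψc]
  refine tendsto_integral_of_dominated_convergence (fun q => C * ‖K.indicator G q‖) (fun n => ?_)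
    (hGK.norm.const_mul C) (fun n => Eventually.of_forall fun q => ?_)
    (Eventually.of_forall fun q => (tendsto_planeConv_mollifier_of_continuous hψ q).const_mul _)
  · exact hG.aestronglyMeasurable.mul
      ((isTest_mollifier n).contDiff_planeConv hψL).continuous.aestronglyMeasurable
  · by_cases hq : q ∈ K
    · rw [indicator_of_mem hq, norm_mul, mul_comm]
      gcongr
      calc ‖planeConv (mollifier n) ψ q‖ ≤ ∫ r, mollifier n (q - r) * C := by
            refine norm_integral_le_of_norm_le
              (((isTest_mollifier n).reflect q).integrable.mul_const C)
              (Eventually.of_forall fun r => ?_)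
            rw [norm_mul, Real.norm_of_nonneg (mollifier_nonneg n _)]
            exact mul_le_mul_of_nonneg_left (hC r) (mollifier_nonneg n _)
        _ = C := by rw [MeasureTheory.integral_mul_const, integral_mollifier_sub, one_mul]
    · have : planeConv (mollifier n) ψ q = 0 := by
        refine integral_eq_zero_of_ae (Eventually.of_forall fun r => ?_)
        by_cases hr : ψ r = 0
        · simp [hr]
        · have : 2 ≤ ‖q - r‖ := by
            by_contra! h
            exact hq ⟨(r, q - r), ⟨subset_tsupport _ hr, by simpa using h.le⟩, by simp⟩
          simp [mollifier_eq_zero this]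
      simp [this, hq]

/-- Dominated convergence where the dominating functions are the mollifications of a fixed
locally integrable function. -/
lemma tendsto_integral_mul_of_le_planeConv {G ψ h : ℝ × ℝ → ℝ} {H : ℕ → ℝ × ℝ → ℝ}
    (hG : LocallyIntegrable G) (hψ : Continuous ψ) (hψc : HasCompactSupport ψ)
    (hH : ∀ n, Continuous (H n)) (hh : Measurable h)
    (hle : ∀ n p, |H n p| ≤ planeConv (mollifier n) G p)
    (hlim : ∀ᵐ p, Tendsto (fun n => H n p) atTop (nhds (h p))) :
    Tendsto (fun n => ∫ p, H n p * ψ p) atTop (nhds (∫ p, h p * ψ p)) := by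
  set g : ℕ → ℝ × ℝ → ℝ := fun n => planeConv (mollifier n) G with hg
  have hgc (n) : Continuous (g n) := ((isTest_mollifier n).contDiff_planeConv hG).continuous
  have hGlim := ae_tendsto_planeConv_mollifier hG
  have hhG : ∀ᵐ p, |h p| ≤ G p := by
    filter_upwards [hGlim, hlim] with p h1 h2
    exact le_of_tendsto_of_tendsto' h2.abs h1 fun n => hle n p
  have hGm := hG.aestronglyMeasurable
  have hψa : Continuous fun p => |ψ p| := hψ.abs
  have hψac : HasCompactSupport fun p => |ψ p| := hψc.comp_left abs_zero
  have iGψ : Integrable fun p => G p * |ψ p| := by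
    simpa [mul_comm] using hG.integrable_smul_left_of_hasCompactSupport hψa hψac
  have igψ (n) : Integrable fun p => g n p * |ψ p| :=
    ((hgc n).mul hψa).integrable_of_hasCompactSupport hψac.mul_left
  have iHψ (n) : Integrable fun p => H n p * ψ p :=
    ((hH n).mul hψ).integrable_of_hasCompactSupport hψc.mul_left
  have ihψ : Integrable fun p => h p * ψ p := by
    refine iGψ.mono (hh.aestronglyMeasurable.mul hψ.aestronglyMeasurable) ?_
    filter_upwards [hhG] with p hp
    rw [norm_mul, norm_mul, Real.norm_eq_abs, Real.norm_eq_abs, Real.norm_eq_abs,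
      Real.norm_eq_abs, abs_abs]
    exact mul_le_mul_of_nonneg_right (hp.trans (le_abs_self _)) (abs_nonneg _)
  -- the negative part of `g n - G` is dominated by `G`
  have l1 : Tendsto (fun n => ∫ p, max (G p - g n p) 0 * |ψ p|) atTop (nhds 0) := by
    have := tendsto_integral_of_dominated_convergence (F := fun n p => max (G p - g n p) 0 * |ψ p|)
      (f := fun _ => (0 : ℝ)) (μ := volume) (fun p => G p * |ψ p|) (fun n => ?_) iGψ
      (fun n => ?_) ?_
    · simpa using this
    · exact ((hGm.sub (hgc n).aestronglyMeasurable).sup aestronglyMeasurable_const).mul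
        hψa.aestronglyMeasurable
    · filter_upwards [hhG] with p hp
      rw [Real.norm_of_nonneg (by positivity)]
      gcongr
      have := (abs_nonneg _).trans (hle n p)
      exact max_le (by simp only [hg]; linarith) ((abs_nonneg _).trans hp)
    · filter_upwards [hGlim] with p hp
      have := ((tendsto_const_nhds (x := G p)).sub hp).max (tendsto_const_nhds (x := (0 : ℝ)))
      simpa using this.mul_const |ψ p|
  have i1 (n) : Integrable fun p => max (G p - g n p) 0 * |ψ p| := by
    refine (iGψ.norm.add (igψ n).norm).mono
      (((hGm.sub (hgc n).aestronglyMeasurable).sup aestronglyMeasurable_const).mul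
        hψa.aestronglyMeasurable) (Eventually.of_forall fun p => ?_)
    simp only [Pi.add_apply, norm_mul, Real.norm_eq_abs, abs_abs, ← add_mul]
    refine mul_le_mul_of_nonneg_right ?_ (abs_nonneg _)
    rw [abs_of_nonneg (le_max_right _ _), abs_of_nonneg (by positivity)]
    exact max_le ((le_abs_self _).trans (abs_sub _ _)) (by positivity)
  have l2 : Tendsto (fun n => ∫ p, ((g n p * |ψ p| - G p * |ψ p|) + max (G p - g n p) 0 * |ψ p|))
      atTop (nhds 0) := by
    have e (n) := MeasureTheory.integral_add ((igψ n).sub iGψ) (i1 n)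
    have e' (n) := MeasureTheory.integral_sub (igψ n) iGψ
    simp only [Pi.sub_apply] at e
    simp only [e, e']
    have := ((tendsto_integral_planeConv_mul hG hψa hψac).sub_const (∫ p, G p * |ψ p|)).add l1
    simpa using this
  have hb (n p) : (g n p * |ψ p| - G p * |ψ p|) + max (G p - g n p) 0 * |ψ p|
      = max (g n p - G p) 0 * |ψ p| := by
    rw [← sub_mul, ← add_mul]
    congr 1
    rcases le_total (G p) (g n p) with h | h
    · rw [max_eq_right (by linarith), max_eq_left (by linarith)]; ring
    · rw [max_eq_left (by linarith), max_eq_right (by linarith)]; ring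
  have i2 (n) : Integrable fun p => max (g n p - G p) 0 * |ψ p| := by
    have := ((igψ n).sub iGψ).add (i1 n)
    refine this.congr (Eventually.of_forall fun p => ?_)
    exact hb n p
  simp only [hb] at l2
  set d : ℕ → ℝ × ℝ → ℝ := fun n p => |H n p * ψ p - h p * ψ p| with hd
  have hdm (n) : AEStronglyMeasurable (d n) volume := ((iHψ n).sub ihψ).abs.aestronglyMeasurable
  have l3 : Tendsto (fun n => ∫ p, max (d n p - max (g n p - G p) 0 * |ψ p|) 0) atTop
      (nhds 0) := by
    have := tendsto_integral_of_dominated_convergence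
      (F := fun n p => max (d n p - max (g n p - G p) 0 * |ψ p|) 0)
      (f := fun _ => (0 : ℝ)) (μ := volume) (fun p => 2 * (G p * |ψ p|)) (fun n => ?_)
      (iGψ.const_mul 2) (fun n => ?_) ?_
    · simpa using this
    · exact ((hdm n).sub (i2 n).aestronglyMeasurable).sup aestronglyMeasurable_const
    · filter_upwards [hhG] with p hp
      rw [Real.norm_of_nonneg (by positivity)]
      have hG0 := (abs_nonneg _).trans hp
      refine max_le ?_ (by positivity)
      have h1 : d n p ≤ (g n p + G p) * |ψ p| := by
        simp only [hd, ← sub_mul, abs_mul]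
        gcongr
        exact (abs_sub _ _).trans (add_le_add (hle n p) hp)
      have h2 : (g n p - G p) * |ψ p| ≤ max (g n p - G p) 0 * |ψ p| := by
        gcongr; exact le_max_left _ _
      linarith
    · filter_upwards [hGlim, hlim] with p h1 h2
      have t1 : Tendsto (fun n => d n p) atTop (nhds 0) := by
        have := ((h2.mul_const (ψ p)).sub_const (h p * ψ p)).abs
        simpa using this
      have t2 : Tendsto (fun n => max (g n p - G p) 0 * |ψ p|) atTop (nhds 0) := by
        have := (h1.sub_const (G p)).max (tendsto_const_nhds (x := (0 : ℝ)))
        simpa using this.mul_const |ψ p|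
      simpa using (t1.sub t2).max (tendsto_const_nhds (x := (0 : ℝ)))
  have i3 (n) : Integrable fun p => max (d n p - max (g n p - G p) 0 * |ψ p|) 0 :=
    (((iHψ n).sub ihψ).abs.sub (i2 n)).sup (integrable_zero _ _ _)
  rw [tendsto_iff_norm_sub_tendsto_zero]
  refine squeeze_zero (fun _ => norm_nonneg _) (fun n => ?_) (by simpa using l3.add l2)
  rw [← MeasureTheory.integral_sub (iHψ n) ihψ, ← MeasureTheory.integral_add (i3 n) (i2 n)]
  refine (MeasureTheory.norm_integral_le_integral_norm _).trans
    (integral_mono ((iHψ n).sub ihψ).norm ((i3 n).add (i2 n)) fun p => ?_)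
  have := le_max_left (d n p - max (g n p - G p) 0 * |ψ p|) 0
  change d n p ≤ _ + _
  linarith

lemma HasCompactSupport.fun_pow {X : Type*} [TopologicalSpace X] {f : X → ℝ}
    (hf : HasCompactSupport f) {n : ℕ} (hn : n ≠ 0) : HasCompactSupport fun x => f x ^ n :=
  hf.comp_left (g := fun a : ℝ => a ^ n) (zero_pow hn)

lemma Continuous.integrable_pow_of_hasCompactSupport {X : Type*} [TopologicalSpace X]
    [MeasurableSpace X] [OpensMeasurableSpace X] {μ : Measure X}
    [IsFiniteMeasureOnCompacts μ] {f : X → ℝ} (hf : Continuous f)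
    (hc : HasCompactSupport f) {n : ℕ} (hn : n ≠ 0) : Integrable (fun x => f x ^ n) μ :=
  (hf.pow n).integrable_of_hasCompactSupport (hc.fun_pow hn)

/-- Agmon's inequality on the line. -/
lemma pow_four_le_integral_sq_mul {f : ℝ → ℝ} (hf : ContDiff ℝ 1 f) (hc : HasCompactSupport f)
    (x : ℝ) : f x ^ 4 ≤ 4 * (∫ y, f y ^ 2) * ∫ y, deriv f y ^ 2 := by
  have hfd : Continuous (deriv f) := hf.continuous_deriv le_rfl
  have hfc := hf.continuous
  have iS : Integrable fun y => f y ^ 2 :=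
    hfc.integrable_pow_of_hasCompactSupport hc two_ne_zero
  have iD : Integrable fun y => deriv f y ^ 2 :=
    hfd.integrable_pow_of_hasCompactSupport hc.deriv two_ne_zero
  have hder (y : ℝ) : deriv (fun y => f y ^ 2) y = 2 * f y * deriv f y := by
    have : HasDerivAt (fun y => f y ^ 2) _ y :=
      (hf.differentiable one_ne_zero y).hasDerivAt.pow 2
    simpa using this.deriv
  have hrep : ∫ y in Iic x, 2 * f y * deriv f y = f x ^ 2 := by
    simpa only [hder] using (hc.fun_pow two_ne_zero).integral_Iic_deriv_eq (hf.pow 2) x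
  have key (l : ℝ) : 0 ≤ (∫ y, f y ^ 2) * (l * l) + (- f x ^ 2) * l + ∫ y, deriv f y ^ 2 := by
    have h1 : l * f x ^ 2 ≤ ∫ y, (l * l * f y ^ 2 + deriv f y ^ 2) := by
      rw [← hrep, ← MeasureTheory.integral_const_mul]
      have iC : Integrable fun y => l * (2 * f y * deriv f y) :=
        (((continuous_const.mul hfc).mul hfd).integrable_of_hasCompactSupport
          hc.deriv.mul_left).const_mul l
      have iSD : Integrable fun y => l * l * f y ^ 2 + deriv f y ^ 2 :=
        (iS.const_mul (l * l)).add iD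
      calc ∫ y in Iic x, l * (2 * f y * deriv f y)
          ≤ ∫ y in Iic x, (l * l * f y ^ 2 + deriv f y ^ 2) :=
            MeasureTheory.integral_mono iC.integrableOn iSD.integrableOn fun y => by
              nlinarith [sq_nonneg (l * f y - deriv f y)]
        _ ≤ _ := setIntegral_le_integral iSD (Eventually.of_forall fun y => by
              simp only [Pi.zero_apply]
              nlinarith [sq_nonneg (l * f y), sq_nonneg (deriv f y)])
    rw [MeasureTheory.integral_add (iS.const_mul _) iD, MeasureTheory.integral_const_mul] at h1
    linarith
  have := discrim_le_zero key
  rw [discrim] at this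
  linarith

/-- A Gagliardo-Nirenberg inequality for test functions on the plane. -/
lemma integral_pow_six_le {F : ℝ × ℝ → ℝ} (hF : IsTest F) {M : ℝ}
    (hM : ∀ t, ∫ x, F (t, x) ^ 2 ≤ M) :
    ∫ p, F p ^ 6 ≤ 4 * M ^ 2 * ∫ p, Dx F p ^ 2 := by
  have hslice (t : ℝ) : ContDiff ℝ 1 fun x => F (t, x) :=
    (hF.smooth.of_le (by simp)).comp (contDiff_prodMk_right t)
  have hcs {G : ℝ × ℝ → ℝ} (hG : IsTest G) (t : ℝ) : HasCompactSupport fun x => G (t, x) :=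
    hG.compact.comp_isClosedEmbedding ⟨isEmbedding_prodMkRight t, by
      rw [show range (Prod.mk t : ℝ → ℝ × ℝ) = Prod.fst ⁻¹' {t} by ext ⟨a, b⟩; simp [eq_comm]]
      exact isClosed_singleton.preimage continuous_fst⟩
  have hder (t x : ℝ) : deriv (fun x => F (t, x)) x = Dx F (t, x) := by
    have h1 := (hF.smooth.differentiable (by simp) (t, x)).hasFDerivAt
    have h2 : HasDerivAt (fun x : ℝ => (t, x)) ((0, 1) : ℝ × ℝ) x :=
      (hasDerivAt_const x t).prodMk (hasDerivAt_id x)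
    exact (h1.comp_hasDerivAt x h2).deriv
  have ipow' {G : ℝ × ℝ → ℝ} (hG : IsTest G) {n : ℕ} (hn : n ≠ 0) (t : ℝ) :
      Integrable fun x => G (t, x) ^ n :=
    (hG.continuous.comp (Continuous.prodMk_right t)).integrable_pow_of_hasCompactSupport
      (hcs hG t) hn
  have i6 : Integrable (fun p => F p ^ 6) :=
    hF.continuous.integrable_pow_of_hasCompactSupport hF.compact (by norm_num)
  have i2 : Integrable (fun p => Dx F p ^ 2) :=
    hF.dx.continuous.integrable_pow_of_hasCompactSupport hF.dx.compact two_ne_zero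
  rw [Measure.volume_eq_prod] at i6 i2 ⊢
  rw [integral_prod _ i6, integral_prod _ i2, ← MeasureTheory.integral_const_mul]
  refine integral_mono i6.integral_prod_left (i2.integral_prod_left.const_mul _) fun t => ?_
  have hS : 0 ≤ ∫ x, F (t, x) ^ 2 := integral_nonneg fun x => sq_nonneg _
  have hD : 0 ≤ ∫ x, Dx F (t, x) ^ 2 := integral_nonneg fun x => sq_nonneg _
  have h4 (x : ℝ) := pow_four_le_integral_sq_mul (hslice t) (hcs hF t) x
  simp only [hder] at h4
  calc ∫ x, F (t, x) ^ 6
      ≤ ∫ x, 4 * (∫ y, F (t, y) ^ 2) * (∫ y, Dx F (t, y) ^ 2) * F (t, x) ^ 2 := by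
        refine integral_mono (ipow' hF (by norm_num) t)
          ((ipow' hF two_ne_zero t).const_mul _) fun x => ?_
        have := mul_le_mul_of_nonneg_right (h4 x) (sq_nonneg (F (t, x)))
        simp only
        linarith
    _ = 4 * (∫ x, F (t, x) ^ 2) ^ 2 * ∫ x, Dx F (t, x) ^ 2 := by
        rw [MeasureTheory.integral_const_mul]; ring
    _ ≤ 4 * M ^ 2 * ∫ x, Dx F (t, x) ^ 2 := by
        gcongr
        exact hM t

/-- Mollification preserves a uniform bound on the spatial `L²` norm. -/
lemma lintegral_planeConv_sq_le (n : ℕ) {v : ℝ × ℝ → ℝ} {M : ℝ} (hvm : Measurable v)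
    (hv : LocallyIntegrable v) (hv2 : LocallyIntegrable (fun p => v p ^ 2))
    (hbd : ∀ᵐ t : ℝ, Integrable (fun x : ℝ => v (t, x) ^ 2) ∧ (∫ x : ℝ, v (t, x) ^ 2) ≤ M)
    (t : ℝ) :
    ∫⁻ x, ENNReal.ofReal (planeConv (mollifier n) v (t, x) ^ 2) ≤ ENNReal.ofReal M := by
  have hρ : Measurable (mollifier n) := (isTest_mollifier n).continuous.measurable
  calc ∫⁻ x, ENNReal.ofReal (planeConv (mollifier n) v (t, x) ^ 2)
      ≤ ∫⁻ x, ∫⁻ q : ℝ × ℝ, ENNReal.ofReal (mollifier n ((t, x) - q)) *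
          ENNReal.ofReal (v q ^ 2) := by
        refine lintegral_mono fun x => ?_
        refine (ENNReal.ofReal_le_ofReal (sq_planeConv_le n hv hv2 (t, x))).trans (le_of_eq ?_)
        rw [planeConv, ofReal_integral_eq_lintegral_ofReal
          (((isTest_mollifier n).reflect _).integrable_mul hv2)
          (Eventually.of_forall fun q => mul_nonneg (mollifier_nonneg n _) (sq_nonneg _))]
        simp only [ENNReal.ofReal_mul (mollifier_nonneg n _)]
    _ = ∫⁻ q : ℝ × ℝ, ∫⁻ x, ENNReal.ofReal (mollifier n ((t, x) - q)) *
          ENNReal.ofReal (v q ^ 2) := by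
        refine lintegral_lintegral_swap (Measurable.aemeasurable ?_)
        fun_prop
    _ = ∫⁻ q : ℝ × ℝ, (∫⁻ x, ENNReal.ofReal (mollifier n (t - q.1, x))) *
          ENNReal.ofReal (v q ^ 2) := by
        congr 1
        funext q
        rw [lintegral_mul_const _ (by fun_prop)]
        congr 1
        exact lintegral_sub_right_eq_self
          (fun x => ENNReal.ofReal (mollifier n (t - q.1, x))) q.2
    _ = ∫⁻ s, ∫⁻ y, (∫⁻ x, ENNReal.ofReal (mollifier n (t - s, x))) *
          ENNReal.ofReal (v (s, y) ^ 2) := by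
        rw [Measure.volume_eq_prod, lintegral_prod]
        have : Measurable fun q : ℝ × ℝ => ∫⁻ x, ENNReal.ofReal (mollifier n (t - q.1, x)) :=
          Measurable.lintegral_prod_right'
            (f := fun z : (ℝ × ℝ) × ℝ => ENNReal.ofReal (mollifier n (t - z.1.1, z.2)))
            (by fun_prop)
        exact (this.mul (by fun_prop)).aemeasurable
    _ ≤ ∫⁻ s, (∫⁻ x, ENNReal.ofReal (mollifier n (t - s, x))) * ENNReal.ofReal M := by
        refine lintegral_mono_ae ?_
        filter_upwards [hbd] with s hs
        rw [lintegral_const_mul _ (by fun_prop)]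
        gcongr
        rw [← ofReal_integral_eq_lintegral_ofReal hs.1 (Eventually.of_forall fun y => sq_nonneg _)]
        exact ENNReal.ofReal_le_ofReal hs.2
    _ = ENNReal.ofReal M := by
        have hm : Measurable fun s => ∫⁻ x, ENNReal.ofReal (mollifier n (s, x)) :=
          Measurable.lintegral_prod_right'
            (f := fun z : ℝ × ℝ => ENNReal.ofReal (mollifier n z)) (by fun_prop)
        have h1 : ∫⁻ s, ∫⁻ x, ENNReal.ofReal (mollifier n (s, x)) = 1 := by
          rw [← lintegral_prod (fun z => ENNReal.ofReal (mollifier n z)) (by fun_prop),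
            ← Measure.volume_eq_prod, ← ofReal_integral_eq_lintegral_ofReal
            (isTest_mollifier n).integrable (Eventually.of_forall (mollifier_nonneg n)),
            integral_mollifier, ENNReal.ofReal_one]
        rw [lintegral_mul_const _
            (show Measurable fun s => ∫⁻ x, ENNReal.ofReal (mollifier n (t - s, x)) from
              hm.comp (measurable_const.sub measurable_id)),
          lintegral_sub_left_eq_self (fun s => ∫⁻ x, ENNReal.ofReal (mollifier n (s, x))) t, h1,
          one_mul]

lemma locallyIntegrable_of_sq {f : ℝ × ℝ → ℝ} (hf : Measurable f)
    (hf2 : LocallyIntegrable (fun p => f p ^ 2)) : LocallyIntegrable f := by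
  refine ((locallyIntegrable_const (1 : ℝ)).add hf2).mono hf.aestronglyMeasurable
    (Eventually.of_forall fun p => ?_)
  simp only [Pi.add_apply, Real.norm_eq_abs]
  rw [abs_of_nonneg (a := 1 + f p ^ 2) (by positivity), ← sq_abs (f p)]
  nlinarith [sq_nonneg (|f p| - 1), abs_nonneg (f p)]

lemma exists_isTest_one_on {K : Set (ℝ × ℝ)} (hK : IsCompact K) :
    ∃ χ, IsTest χ ∧ (∀ p, χ p ∈ Icc (0 : ℝ) 1) ∧ ∀ p ∈ K, χ p = 1 := by
  obtain ⟨R, hR⟩ := hK.isBounded.subset_closedBall 0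
  let b : ContDiffBump (0 : ℝ × ℝ) := ⟨max R 1, max R 1 + 1, by positivity, by linarith⟩
  exact ⟨b, ⟨b.contDiff, b.hasCompactSupport⟩, fun p => ⟨b.nonneg, b.le_one⟩, fun p hp =>
    b.one_of_mem_closedBall (Metric.closedBall_subset_closedBall (le_max_left R 1) (hR hp))⟩

/-- Mollification commutes with weak differentiation. -/
lemma Dx_planeConv_of_weak {k v w : ℝ × ℝ → ℝ} (hk : IsTest k) (hv : LocallyIntegrable v)
    (hweak : ∀ φ : ℝ × ℝ → ℝ, ContDiff ℝ (⊤ : ℕ∞) φ → HasCompactSupport φ →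
      (∫ p : ℝ × ℝ, v p * Dx φ p) = - ∫ p : ℝ × ℝ, w p * φ p) :
    Dx (planeConv k v) = planeConv k w := by
  rw [hk.dx_planeConv hv]
  funext p
  have h := hweak _ (hk.reflect p).smooth (hk.reflect p).compact
  simp only [hk.dx_reflect, mul_neg, MeasureTheory.integral_neg, neg_inj] at h
  simpa only [planeConv, mul_comm] using h

/-- Functions with spatial `L²` norm bounded in time and locally square integrable weak `x`
derivative are locally in `L⁶`. -/
lemma locallyIntegrable_pow_six {v w : ℝ × ℝ → ℝ} {M : ℝ} (hvm : Measurable v)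
    (hv : LocallyIntegrable v) (hv2 : LocallyIntegrable (fun p => v p ^ 2))
    (hw : LocallyIntegrable w) (hw2 : LocallyIntegrable (fun p => w p ^ 2))
    (hbd : ∀ᵐ t : ℝ, Integrable (fun x : ℝ => v (t, x) ^ 2) ∧ (∫ x : ℝ, v (t, x) ^ 2) ≤ M)
    (hweak : ∀ φ : ℝ × ℝ → ℝ, ContDiff ℝ (⊤ : ℕ∞) φ → HasCompactSupport φ →
      (∫ p : ℝ × ℝ, v p * Dx φ p) = - ∫ p : ℝ × ℝ, w p * φ p) :
    LocallyIntegrable (fun p => v p ^ 6) := by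
  have hM : 0 ≤ M := by
    obtain ⟨t, ht⟩ := hbd.exists
    exact (integral_nonneg fun x => sq_nonneg _).trans ht.2
  rw [locallyIntegrable_iff]
  intro K hK
  obtain ⟨χ, hχ, hχ01, hχK⟩ := exists_isTest_one_on hK
  set V : ℕ → ℝ × ℝ → ℝ := fun n => planeConv (mollifier n) v with hV
  have hVs (n) : ContDiff ℝ (⊤ : ℕ∞) (V n) := (isTest_mollifier n).contDiff_planeConv hv
  have hF (n) : IsTest fun p => V n p * χ p := hχ.mul_left (hVs n)
  set a : ℕ → ℝ := fun n => 2 * (∫ p, planeConv (mollifier n) (fun p => w p ^ 2) p * χ p ^ 2)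
    + 2 * ∫ p, planeConv (mollifier n) (fun p => v p ^ 2) p * Dx χ p ^ 2 with ha
  have hcs {ψ : ℝ × ℝ → ℝ} (hψ : IsTest ψ) : HasCompactSupport fun p => ψ p ^ 2 :=
    hψ.compact.fun_pow two_ne_zero
  have halim : ∃ B, ∀ n, a n ≤ B := by
    have := ((tendsto_integral_planeConv_mul hw2 (hχ.continuous.pow 2) (hcs hχ)).const_mul 2).add
      ((tendsto_integral_planeConv_mul hv2 (hχ.dx.continuous.pow 2) (hcs hχ.dx)).const_mul 2)
    obtain ⟨B, hB⟩ := this.bddAbove_range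
    exact ⟨B, fun n => hB ⟨n, rfl⟩⟩
  obtain ⟨B, hB⟩ := halim
  have hDa (n) : ∫ p, Dx (fun p => V n p * χ p) p ^ 2 ≤ a n := by
    have hi {g ψ : ℝ × ℝ → ℝ} (hg : LocallyIntegrable g) (hψ : IsTest ψ) :
        Integrable fun p => planeConv (mollifier n) g p * ψ p ^ 2 :=
      (((isTest_mollifier n).contDiff_planeConv hg).continuous.mul
        (hψ.continuous.pow 2)).integrable_of_hasCompactSupport (hcs hψ).mul_left
    rw [ha]
    simp only
    rw [← MeasureTheory.integral_const_mul, ← MeasureTheory.integral_const_mul,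
      ← MeasureTheory.integral_add ((hi hw2 hχ).const_mul 2) ((hi hv2 hχ.dx).const_mul 2)]
    refine integral_mono (((hF n).dx.continuous.pow 2).integrable_of_hasCompactSupport
      (hcs (hF n).dx)) (((hi hw2 hχ).const_mul 2).add ((hi hv2 hχ.dx).const_mul 2)) fun p => ?_
    have hd : Dx (fun p => V n p * χ p) p = planeConv (mollifier n) w p * χ p
        + planeConv (mollifier n) v p * Dx χ p := by
      rw [Dx_mul (hVs n) hχ.smooth]
      simp only [hV, Dx_planeConv_of_weak (isTest_mollifier n) hv hweak]
    simp only [hd]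
    have h1 := mul_le_mul_of_nonneg_right (sq_planeConv_le n hw hw2 p) (sq_nonneg (χ p))
    have h2 := mul_le_mul_of_nonneg_right (sq_planeConv_le n hv hv2 p) (sq_nonneg (Dx χ p))
    nlinarith [sq_nonneg (planeConv (mollifier n) w p * χ p
      - planeConv (mollifier n) v p * Dx χ p)]
  have hS (n) (t : ℝ) : ∫ x, (V n (t, x) * χ (t, x)) ^ 2 ≤ M := by
    have hm : Continuous fun x => (V n (t, x) * χ (t, x)) ^ 2 :=
      ((hF n).continuous.comp (Continuous.prodMk_right t)).pow 2
    rw [integral_eq_lintegral_of_nonneg_ae (Eventually.of_forall fun x => sq_nonneg _)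
      hm.aestronglyMeasurable]
    refine ENNReal.toReal_le_of_le_ofReal hM (le_trans (lintegral_mono fun x => ?_)
      (lintegral_planeConv_sq_le n hvm hv hv2 hbd t))
    refine ENNReal.ofReal_le_ofReal ?_
    rw [mul_pow]
    exact mul_le_of_le_one_right (sq_nonneg _)
      (pow_le_one₀ (hχ01 (t, x)).1 (hχ01 (t, x)).2)
  have h6 (n) : ∫⁻ p, ENNReal.ofReal ((V n p * χ p) ^ 6) ≤ ENNReal.ofReal (4 * M ^ 2 * B) := by
    rw [← ofReal_integral_eq_lintegral_ofReal
      ((hF n).continuous.integrable_pow_of_hasCompactSupport (hF n).compact (by norm_num))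
      (Eventually.of_forall fun p => (by norm_num : Even 6).pow_nonneg _)]
    refine ENNReal.ofReal_le_ofReal ((integral_pow_six_le (hF n) (hS n)).trans ?_)
    exact mul_le_mul_of_nonneg_left ((hDa n).trans (hB n)) (by positivity)
  have hfatou : ∫⁻ p, ENNReal.ofReal ((v p * χ p) ^ 6) ≤ ENNReal.ofReal (4 * M ^ 2 * B) := by
    calc ∫⁻ p, ENNReal.ofReal ((v p * χ p) ^ 6)
        = ∫⁻ p, liminf (fun n => ENNReal.ofReal ((V n p * χ p) ^ 6)) atTop := by
          refine lintegral_congr_ae ?_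
          filter_upwards [ae_tendsto_planeConv_mollifier hv] with p hp
          exact (ENNReal.tendsto_ofReal ((hp.mul_const (χ p)).pow 6)).liminf_eq.symm
      _ ≤ liminf (fun n => ∫⁻ p, ENNReal.ofReal ((V n p * χ p) ^ 6)) atTop :=
          lintegral_liminf_le fun n => ((hF n).continuous.pow 6).measurable.ennreal_ofReal
      _ ≤ _ := by
          refine (liminf_le_liminf (Eventually.of_forall h6)).trans ?_
          simp
  have hint : Integrable fun p => (v p * χ p) ^ 6 := by
    refine ⟨((hvm.mul hχ.continuous.measurable).pow_const 6).aestronglyMeasurable, ?_⟩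
    rw [hasFiniteIntegral_iff_ofReal (Eventually.of_forall fun p => by positivity)]
    exact hfatou.trans_lt ENNReal.ofReal_lt_top
  refine hint.integrableOn.congr_fun (fun p hp => ?_) hK.measurableSet
  simp [hχK p hp]

lemma Dt_Dx {φ : ℝ × ℝ → ℝ} (hφ : ContDiff ℝ (⊤ : ℕ∞) φ) : Dt (Dx φ) = Dx (Dt φ) := by
  have hd : Differentiable ℝ (fderiv ℝ φ) :=
    (hφ.fderiv_right (m := ((⊤ : ℕ∞) : WithTop ℕ∞)) (by simp)).differentiable (by simp)
  have happ (e e' p : ℝ × ℝ) :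
      fderiv ℝ (fun q => fderiv ℝ φ q e) p e' = fderiv ℝ (fderiv ℝ φ) p e' e := by
    rw [fderiv_clm_apply (hd p) (differentiableAt_const e)]
    simp
  funext p
  change fderiv ℝ (fun q => fderiv ℝ φ q (0, 1)) p (1, 0)
    = fderiv ℝ (fun q => fderiv ℝ φ q (1, 0)) p (0, 1)
  rw [happ, happ]
  have h2 : (2 : WithTop ℕ∞) ≤ ((⊤ : ℕ∞) : WithTop ℕ∞) :=
    WithTop.coe_le_coe.2 (le_top : (2 : ℕ∞) ≤ ⊤)
  exact (hφ.contDiffAt.isSymmSndFDerivAt (by simpa using h2)).eq _ _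

lemma integral_linear_combination₃ {f g h : ℝ × ℝ → ℝ} (hf : Integrable f) (hg : Integrable g)
    (hh : Integrable h) (a b c : ℝ) :
    ∫ p, (a * f p + b * g p + c * h p) = a * (∫ p, f p) + b * (∫ p, g p) + c * ∫ p, h p := by
  have h1 := MeasureTheory.integral_add (hf.const_mul a) (hg.const_mul b)
  have h2 := MeasureTheory.integral_add ((hf.const_mul a).add (hg.const_mul b)) (hh.const_mul c)
  simp only [Pi.add_apply] at h2
  rw [h2, h1]
  simp only [MeasureTheory.integral_const_mul]

lemma integral_linear_combination₅ {f g h k l : ℝ × ℝ → ℝ} (hf : Integrable f)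
    (hg : Integrable g) (hh : Integrable h) (hk : Integrable k) (hl : Integrable l)
    (a b c d e : ℝ) :
    ∫ p, (a * f p + b * g p + c * h p + d * k p + e * l p)
      = a * (∫ p, f p) + b * (∫ p, g p) + c * (∫ p, h p) + d * (∫ p, k p) + e * ∫ p, l p := by
  have i3 : Integrable fun p => a * f p + b * g p + c * h p :=
    ((hf.const_mul a).add (hg.const_mul b)).add (hh.const_mul c)
  have h2 := integral_linear_combination₃ i3 hk hl 1 d e
  simpa only [one_mul, integral_linear_combination₃ hf hg hh] using h2

lemma IsTest.integrable_mul_right {f φ : ℝ × ℝ → ℝ} (hφ : IsTest φ) (hf : LocallyIntegrable f) :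
    Integrable (fun p => f p * φ p) := by
  simpa only [mul_comm] using hφ.integrable_mul hf

/-- Mollifications of weak solutions of mKdV solve the mollified equation. -/
lemma mkdv_planeConv {k v : ℝ × ℝ → ℝ} (hk : IsTest k) (hv : LocallyIntegrable v)
    (hv3 : LocallyIntegrable (fun p => v p ^ 3))
    (hmkdv : ∀ φ : ℝ × ℝ → ℝ, ContDiff ℝ (⊤ : ℕ∞) φ → HasCompactSupport φ →
      (∫ p : ℝ × ℝ,
        (- v p * Dt φ p - v p * Dx (Dx (Dx φ)) p + 2 * v p ^ 3 * Dx φ p)) = 0) (p : ℝ × ℝ) :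
    Dt (planeConv k v) p + Dx (Dx (Dx (planeConv k v))) p
      = 2 * Dx (planeConv k fun p => v p ^ 3) p := by
  rw [hk.dt_planeConv hv, hk.dx_planeConv hv, hk.dx.dx_planeConv hv, hk.dx.dx.dx_planeConv hv,
    hk.dx_planeConv hv3]
  have h := hmkdv _ (hk.reflect p).smooth (hk.reflect p).compact
  rw [hk.dx_reflect, hk.dt_reflect, ← hk.dx_reflect, hk.dx_dx_dx_reflect, hk.dx_reflect] at h
  have h3 := integral_linear_combination₃ ((hk.dt.reflect p).integrable_mul hv)
    ((hk.dx.dx.dx.reflect p).integrable_mul hv) ((hk.dx.reflect p).integrable_mul hv3) 1 1 (-2)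
  have h4 : ∫ q, (1 * (Dt k (p - q) * v q) + 1 * (Dx (Dx (Dx k)) (p - q) * v q)
      + -2 * (Dx k (p - q) * v q ^ 3)) = 0 := by
    rw [← h]
    congr 1
    funext q
    ring
  rw [h3] at h4
  simp only [planeConv]
  linarith

/-- Local integrability and weak differentiability properties shared by the functions `v` and
`w = ∂ₓ v` below. -/
structure IsWeakDx (v w : ℝ × ℝ → ℝ) : Prop where
  meas : Measurable v
  meas_dx : Measurable w
  loc : LocallyIntegrable v
  loc_sq : LocallyIntegrable fun p => v p ^ 2
  loc_pow_six : LocallyIntegrable fun p => v p ^ 6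
  loc_dx : LocallyIntegrable w
  loc_dx_sq : LocallyIntegrable fun p => w p ^ 2
  weak : ∀ φ : ℝ × ℝ → ℝ, ContDiff ℝ (⊤ : ℕ∞) φ → HasCompactSupport φ →
    (∫ p : ℝ × ℝ, v p * Dx φ p) = - ∫ p : ℝ × ℝ, w p * φ p

namespace IsWeakDx

variable {v w φ : ℝ × ℝ → ℝ}

lemma loc_pow_three (h : IsWeakDx v w) : LocallyIntegrable fun p => v p ^ 3 :=
  locallyIntegrable_of_sq (h.meas.pow_const 3) (by simpa only [← pow_mul] using h.loc_pow_six)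

lemma loc_bound (h : IsWeakDx v w) :
    LocallyIntegrable fun p => v p ^ 2 + w p ^ 2 + v p ^ 6 + (v p ^ 3) ^ 2 := by
  have h6 : LocallyIntegrable fun p => (v p ^ 3) ^ 2 := by
    simpa only [← pow_mul] using h.loc_pow_six
  exact ((h.loc_sq.add h.loc_dx_sq).add h.loc_pow_six).add h6

lemma locallyIntegrable_comp (h : IsWeakDx v w) {P : ℝ → ℝ → ℝ → ℝ}
    (hP : Continuous fun z : ℝ × ℝ × ℝ => P z.1 z.2.1 z.2.2)
    (hle : ∀ a b c, |P a b c| ≤ a ^ 2 + b ^ 2 + a ^ 6 + c ^ 2) :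
    LocallyIntegrable fun p => P (v p) (w p) (v p ^ 3) := by
  refine h.loc_bound.mono (hP.measurable.comp
    (h.meas.prodMk (h.meas_dx.prodMk (h.meas.pow_const 3)))).aestronglyMeasurable
    (Eventually.of_forall fun p => ?_)
  rw [Real.norm_eq_abs]
  exact (hle _ _ _).trans (le_abs_self _)

/-- Convergence of nonlinear expressions in the mollifications of `v`, `∂ₓ v` and `v ^ 3`. -/
lemma tendsto_integral_comp (h : IsWeakDx v w) (hφ : IsTest φ) {P : ℝ → ℝ → ℝ → ℝ}
    (hP : Continuous fun z : ℝ × ℝ × ℝ => P z.1 z.2.1 z.2.2)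
    (hle : ∀ a b c, |P a b c| ≤ a ^ 2 + b ^ 2 + a ^ 6 + c ^ 2) :
    Tendsto (fun n => ∫ p, P (planeConv (mollifier n) v p) (planeConv (mollifier n) w p)
      (planeConv (mollifier n) (fun p => v p ^ 3) p) * φ p) atTop
      (nhds (∫ p, P (v p) (w p) (v p ^ 3) * φ p)) := by
  have h6 : LocallyIntegrable fun p => (v p ^ 3) ^ 2 := by
    simpa only [← pow_mul] using h.loc_pow_six
  have hc {f : ℝ × ℝ → ℝ} (hf : LocallyIntegrable f) (n : ℕ) :
      Continuous (planeConv (mollifier n) f) :=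
    ((isTest_mollifier n).contDiff_planeConv hf).continuous
  refine tendsto_integral_mul_of_le_planeConv h.loc_bound hφ.continuous hφ.compact
    (H := fun n p => P (planeConv (mollifier n) v p) (planeConv (mollifier n) w p)
      (planeConv (mollifier n) (fun p => v p ^ 3) p))
    (fun n => hP.comp ((hc h.loc n).prodMk ((hc h.loc_dx n).prodMk (hc h.loc_pow_three n))))
    (hP.measurable.comp (h.meas.prodMk (h.meas_dx.prodMk (h.meas.pow_const 3))))
    (fun n p => (hle _ _ _).trans ?_) ?_
  · have hk := (isTest_mollifier n).reflect p
    have hsum : planeConv (mollifier n) (fun p => v p ^ 2 + w p ^ 2 + v p ^ 6 + (v p ^ 3) ^ 2) p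
        = planeConv (mollifier n) (fun p => v p ^ 2) p
          + planeConv (mollifier n) (fun p => w p ^ 2) p
          + planeConv (mollifier n) (fun p => v p ^ 6) p
          + planeConv (mollifier n) (fun p => (v p ^ 3) ^ 2) p := by
      have := integral_linear_combination₅ (hk.integrable_mul h.loc_sq)
        (hk.integrable_mul h.loc_dx_sq) (hk.integrable_mul h.loc_pow_six) (hk.integrable_mul h6)
        (hk.integrable_mul h6) 1 1 1 1 0
      simpa only [planeConv, mul_add, one_mul, zero_mul, add_zero] using this
    rw [hsum]
    gcongr
    · exact sq_planeConv_le n h.loc h.loc_sq p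
    · exact sq_planeConv_le n h.loc_dx h.loc_dx_sq p
    · exact pow_six_planeConv_le n h.loc h.loc_pow_six p
    · exact sq_planeConv_le n h.loc_pow_three h6 p
  · filter_upwards [ae_tendsto_planeConv_mollifier h.loc, ae_tendsto_planeConv_mollifier h.loc_dx,
      ae_tendsto_planeConv_mollifier h.loc_pow_three] with p h1 h2 h3
    exact (hP.tendsto (v p, w p, v p ^ 3)).comp (h1.prodMk_nhds (h2.prodMk_nhds h3))

lemma pow_four_bound (a b c : ℝ) : |a ^ 4| ≤ a ^ 2 + b ^ 2 + a ^ 6 + c ^ 2 := by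
  rw [abs_of_nonneg (by positivity)]
  nlinarith [sq_nonneg (a ^ 3 - a), sq_nonneg a, sq_nonneg b, sq_nonneg (a ^ 3), sq_nonneg c]

lemma pow_three_bound (a b c : ℝ) : |a ^ 3| ≤ a ^ 2 + b ^ 2 + a ^ 6 + c ^ 2 := by
  rw [abs_le]
  constructor <;>
  nlinarith [sq_nonneg (a ^ 2 - a), sq_nonneg (a ^ 2 + a), sq_nonneg (a ^ 3 - a), sq_nonneg a,
    sq_nonneg b, sq_nonneg (a ^ 3), sq_nonneg c]

lemma sq_mul_bound (a b c : ℝ) : |a ^ 2 * b| ≤ a ^ 2 + b ^ 2 + a ^ 6 + c ^ 2 := by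
  rw [abs_le]
  constructor <;>
  nlinarith [sq_nonneg (a ^ 2 - b), sq_nonneg (a ^ 2 + b), sq_nonneg (a ^ 3 - a), sq_nonneg a,
    sq_nonneg b, sq_nonneg (a ^ 3), sq_nonneg c]

lemma pow_three_mul_bound (a b c : ℝ) : |a ^ 3 * b| ≤ a ^ 2 + b ^ 2 + a ^ 6 + c ^ 2 := by
  rw [abs_le]
  constructor <;>
  nlinarith [sq_nonneg (a ^ 3 - b), sq_nonneg (a ^ 3 + b), sq_nonneg a, sq_nonneg b,
    sq_nonneg (a ^ 3), sq_nonneg c]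

lemma loc_pow_four (h : IsWeakDx v w) : LocallyIntegrable fun p => v p ^ 4 :=
  h.locallyIntegrable_comp (P := fun a _ _ => a ^ 4) (by fun_prop) pow_four_bound

lemma loc_sq_mul (h : IsWeakDx v w) : LocallyIntegrable fun p => v p ^ 2 * w p :=
  h.locallyIntegrable_comp (P := fun a b _ => a ^ 2 * b) (by fun_prop) sq_mul_bound

/-- Chain rule for `v ^ 3`. -/
lemma integral_pow_three_mul_dx (h : IsWeakDx v w) (hφ : IsTest φ) :
    (∫ p, v p ^ 3 * Dx φ p) + 3 * ∫ p, v p ^ 2 * w p * φ p = 0 := by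
  have hlim := (h.tendsto_integral_comp hφ.dx (P := fun a _ _ => a ^ 3) (by fun_prop)
    pow_three_bound).add ((h.tendsto_integral_comp hφ (P := fun a b _ => a ^ 2 * b) (by fun_prop)
    sq_mul_bound).const_mul 3)
  refine tendsto_nhds_unique hlim (tendsto_const_nhds.congr fun n => ?_)
  have := integral_pow_mul_dx ((isTest_mollifier n).contDiff_planeConv h.loc) hφ 3
  rw [Dx_planeConv_of_weak (isTest_mollifier n) h.loc h.weak] at this
  exact this.symm

/-- Chain rule for `v ^ 4`. -/
lemma integral_pow_four_mul_dx (h : IsWeakDx v w) (hφ : IsTest φ) :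
    (∫ p, v p ^ 4 * Dx φ p) + 4 * ∫ p, v p ^ 3 * w p * φ p = 0 := by
  have hlim := (h.tendsto_integral_comp hφ.dx (P := fun a _ _ => a ^ 4) (by fun_prop)
    pow_four_bound).add ((h.tendsto_integral_comp hφ (P := fun a b _ => a ^ 3 * b) (by fun_prop)
    pow_three_mul_bound).const_mul 4)
  refine tendsto_nhds_unique hlim (tendsto_const_nhds.congr fun n => ?_)
  have := integral_pow_mul_dx ((isTest_mollifier n).contDiff_planeConv h.loc) hφ 4
  rw [Dx_planeConv_of_weak (isTest_mollifier n) h.loc h.weak] at this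
  exact this.symm

/-- The local conservation law for `v ^ 2`. -/
lemma integral_sq_conservation (h : IsWeakDx v w)
    (hmkdv : ∀ φ : ℝ × ℝ → ℝ, ContDiff ℝ (⊤ : ℕ∞) φ → HasCompactSupport φ →
      (∫ p : ℝ × ℝ,
        (- v p * Dt φ p - v p * Dx (Dx (Dx φ)) p + 2 * v p ^ 3 * Dx φ p)) = 0)
    (hφ : IsTest φ) :
    - (∫ p, v p ^ 2 * Dt φ p) - (∫ p, v p ^ 2 * Dx (Dx (Dx φ)) p)
      + 3 * (∫ p, w p ^ 2 * Dx φ p) + 3 * ∫ p, v p ^ 4 * Dx φ p = 0 := by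
  have hsq (a b c : ℝ) : |a ^ 2| ≤ a ^ 2 + b ^ 2 + a ^ 6 + c ^ 2 := by
    rw [abs_of_nonneg (by positivity)]
    nlinarith [sq_nonneg b, sq_nonneg (a ^ 3), sq_nonneg c]
  have hlim := ((((((h.tendsto_integral_comp hφ.dt (P := fun a _ _ => a ^ 2) (by fun_prop)
    hsq).const_mul (-1)).add ((h.tendsto_integral_comp hφ.dx.dx.dx (P := fun a _ _ => a ^ 2)
    (by fun_prop) hsq).const_mul (-1))).add
    ((h.tendsto_integral_comp hφ.dx (P := fun _ b _ => b ^ 2) (by fun_prop) fun a b c => by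
      rw [abs_of_nonneg (by positivity)]
      nlinarith [sq_nonneg a, sq_nonneg (a ^ 3), sq_nonneg c]).const_mul 3)).add
    ((h.tendsto_integral_comp hφ (P := fun _ b c => c * b) (by fun_prop) fun a b c => by
      rw [abs_le]
      constructor <;> nlinarith [sq_nonneg a, sq_nonneg b, sq_nonneg c, sq_nonneg (a ^ 3),
        sq_nonneg (b + c), sq_nonneg (b - c)]).const_mul 4)).add
    ((h.tendsto_integral_comp hφ.dx (P := fun a _ c => c * a) (by fun_prop) fun a b c => by
      rw [abs_le]
      constructor <;> nlinarith [sq_nonneg a, sq_nonneg b, sq_nonneg c, sq_nonneg (a ^ 3),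
        sq_nonneg (a + c), sq_nonneg (a - c)]).const_mul 4))
  have key := tendsto_nhds_unique hlim ((tendsto_const_nhds (x := (0 : ℝ))).congr fun n => ?_)
  · have h4 := h.integral_pow_four_mul_dx hφ
    have e (p : ℝ × ℝ) : v p ^ 3 * v p = v p ^ 4 := by ring
    simp only [e] at key
    linarith
  · have hk := isTest_mollifier n
    have hV := hk.contDiff_planeConv h.loc
    have hC := hk.contDiff_planeConv h.loc_pow_three
    have hW := hk.contDiff_planeConv h.loc_dx
    have h0 := integral_sq_conservation_of_smooth hV hC hφ
      (mkdv_planeConv hk h.loc h.loc_pow_three hmkdv)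
    rw [Dx_planeConv_of_weak hk h.loc h.weak] at h0
    rw [← integral_linear_combination₅ (hφ.dt.mul_left (hV.pow 2)).integrable
      (hφ.dx.dx.dx.mul_left (hV.pow 2)).integrable (hφ.dx.mul_left (hW.pow 2)).integrable
      (hφ.mul_left (hC.mul hW)).integrable (hφ.dx.mul_left (hC.mul hV)).integrable, ← h0]
    congr 1
    funext p
    ring

/-- The equation satisfied by `∂ₓ v`. -/
lemma integral_dx_equation (h : IsWeakDx v w)
    (hmkdv : ∀ φ : ℝ × ℝ → ℝ, ContDiff ℝ (⊤ : ℕ∞) φ → HasCompactSupport φ →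
      (∫ p : ℝ × ℝ,
        (- v p * Dt φ p - v p * Dx (Dx (Dx φ)) p + 2 * v p ^ 3 * Dx φ p)) = 0)
    (hφ : IsTest φ) :
    - (∫ p, w p * Dt φ p) - (∫ p, w p * Dx (Dx (Dx φ)) p)
      + 6 * ∫ p, v p ^ 2 * w p * Dx φ p = 0 := by
  have h1 := h.weak _ hφ.dt.smooth hφ.dt.compact
  have h2 := h.weak _ hφ.dx.dx.dx.smooth hφ.dx.dx.dx.compact
  have h3 := h.integral_pow_three_mul_dx hφ.dx
  have h4 := integral_linear_combination₃ (hφ.dt.dx.integrable_mul_right h.loc)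
    (hφ.dx.dx.dx.dx.integrable_mul_right h.loc)
    (hφ.dx.dx.integrable_mul_right h.loc_pow_three) (-1) (-1) 2
  have h5 := hmkdv _ hφ.dx.smooth hφ.dx.compact
  rw [Dt_Dx hφ.smooth] at h5
  have h6 : ∫ p, (-1 * (v p * Dx (Dt φ) p) + -1 * (v p * Dx (Dx (Dx (Dx φ))) p)
      + 2 * (v p ^ 3 * Dx (Dx φ) p)) = 0 := by
    rw [← h5]
    congr 1
    funext p
    ring
  linarith

end IsWeakDx

/-- **Proposition (the Miura map sends weak solutions of mKdV to weak solutions of KdV).**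
Let `v = v(t,x)` be measurable with `ess sup_t ‖v(t,·)‖_{L²(ℝ)} < ∞`, `v ∈ L²_loc(ℝ²)`,
with weak `x`-derivative `w = ∂ₓv ∈ L²_loc(ℝ²)`, and let `v` be a weak solution of mKdV:
`∫∫ (-v φ_t - v φ_{xxx} + 2 v³ φ_x) = 0` for all test functions `φ`. Then `u = ∂ₓ v + v²`
belongs to `L²_loc(ℝ²)` and is a weak solution of KdV:
`∫∫ (-u φ_t - u φ_{xxx} + 3 u² φ_x) = 0` for all test functions `φ`. -/
theorem miura_weak_mkdv_to_kdv (v w : ℝ × ℝ → ℝ)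
    (hvm : Measurable v) (hwm : Measurable w)
    (hbd : ∃ M : ℝ, ∀ᵐ t : ℝ ∂volume,
      Integrable (fun x : ℝ => v (t, x) ^ 2) volume ∧ (∫ x : ℝ, v (t, x) ^ 2) ≤ M)
    (hv2 : LocallyIntegrable (fun p : ℝ × ℝ => v p ^ 2) volume)
    (hw2 : LocallyIntegrable (fun p : ℝ × ℝ => w p ^ 2) volume)
    (hweakderiv : ∀ φ : ℝ × ℝ → ℝ, ContDiff ℝ (⊤ : ℕ∞) φ → HasCompactSupport φ →
      (∫ p : ℝ × ℝ, v p * Dx φ p) = - ∫ p : ℝ × ℝ, w p * φ p)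
    (hmkdv : ∀ φ : ℝ × ℝ → ℝ, ContDiff ℝ (⊤ : ℕ∞) φ → HasCompactSupport φ →
      (∫ p : ℝ × ℝ,
        (- v p * Dt φ p - v p * Dx (Dx (Dx φ)) p + 2 * v p ^ 3 * Dx φ p)) = 0) :
    LocallyIntegrable (fun p : ℝ × ℝ => (w p + v p ^ 2) ^ 2) volume ∧
    ∀ φ : ℝ × ℝ → ℝ, ContDiff ℝ (⊤ : ℕ∞) φ → HasCompactSupport φ →
      (∫ p : ℝ × ℝ,
        (- (w p + v p ^ 2) * Dt φ p - (w p + v p ^ 2) * Dx (Dx (Dx φ)) p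
          + 3 * (w p + v p ^ 2) ^ 2 * Dx φ p)) = 0 := by
  have hv := locallyIntegrable_of_sq hvm hv2
  have hw := locallyIntegrable_of_sq hwm hw2
  obtain ⟨M, hM⟩ := hbd
  have h : IsWeakDx v w := ⟨hvm, hwm, hv, hv2,
    locallyIntegrable_pow_six hvm hv hv2 hw hw2 hM hweakderiv, hw, hw2, hweakderiv⟩
  have hexp (p : ℝ × ℝ) : (w p + v p ^ 2) ^ 2 = w p ^ 2 + 2 * (v p ^ 2 * w p) + v p ^ 4 := by
    ring
  refine ⟨?_, fun φ hφs hφc => ?_⟩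
  · simp only [hexp]
    exact (hw2.add (h.loc_sq_mul.smul (2 : ℝ))).add h.loc_pow_four
  · have hφ : IsTest φ := ⟨hφs, hφc⟩
    have hA := h.integral_dx_equation hmkdv hφ
    have hB := h.integral_sq_conservation hmkdv hφ
    have i1 := integral_linear_combination₃ (hφ.dt.integrable_mul_right hw)
      (hφ.dx.dx.dx.integrable_mul_right hw) (hφ.dx.integrable_mul_right h.loc_sq_mul) (-1) (-1) 6
    have j1 : Integrable fun p => -1 * (w p * Dt φ p) + -1 * (w p * Dx (Dx (Dx φ)) p)
        + 6 * (v p ^ 2 * w p * Dx φ p) :=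
      (((hφ.dt.integrable_mul_right hw).const_mul _).add
        ((hφ.dx.dx.dx.integrable_mul_right hw).const_mul _)).add
        ((hφ.dx.integrable_mul_right h.loc_sq_mul).const_mul _)
    have i2 := integral_linear_combination₅ j1 (hφ.dt.integrable_mul_right hv2)
      (hφ.dx.dx.dx.integrable_mul_right hv2) (hφ.dx.integrable_mul_right hw2)
      (hφ.dx.integrable_mul_right h.loc_pow_four) 1 (-1) (-1) 3 3
    rw [i1] at i2
    trans ∫ p, (1 * (-1 * (w p * Dt φ p) + -1 * (w p * Dx (Dx (Dx φ)) p)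
        + 6 * (v p ^ 2 * w p * Dx φ p)) + -1 * (v p ^ 2 * Dt φ p)
        + -1 * (v p ^ 2 * Dx (Dx (Dx φ)) p) + 3 * (w p ^ 2 * Dx φ p) + 3 * (v p ^ 4 * Dx φ p))
    · congr 1
      funext p
      ring
    · rw [i2]
      linarith
end

section
/- Let v ∈ C^∞(ℝ × ℝ; ℝ) (variables (t,x)) and set u = B(v) := v_x + v². Then, identically on ℝ²: u_t − 6 u u_x + u_{xxx} = ∂_x(v_t − 6 v² v_x + v_{xxx}) + 2 v · (v_t − 6 v² v_x + v_{xxx}). In particular, if v is a classical solution of the modified Korteweg–de Vries equation v_t − 6v²v_x + v_{xxx} = 0, then u = v_x + v² is a classical solution of the Korteweg–de Vries equation u_t − 6uu_x + u_{xxx} = 0. -/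
open MeasureTheory Filter Set

/-- Partial derivative in the space variable `x` of a smooth function of `(t,x)`. -/
noncomputable def pdx (f : ℝ → ℝ → ℝ) : ℝ → ℝ → ℝ := fun t x => deriv (fun y => f t y) x

/-- Partial derivative in the time variable `t` of a smooth function of `(t,x)`. -/
noncomputable def pdt (f : ℝ → ℝ → ℝ) : ℝ → ℝ → ℝ := fun t x => deriv (fun s => f s x) t

section PartialDerivatives

variable {f : ℝ → ℝ → ℝ}

theorem hasDerivAt_slice_right {n : WithTop ℕ∞} (hf : ContDiff ℝ n (Function.uncurry f))
    (hn : n ≠ 0) (t x : ℝ) :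
    HasDerivAt (fun y => f t y) (fderiv ℝ (Function.uncurry f) (t, x) (0, 1)) x :=
  ((hf.differentiable hn) (t, x)).hasFDerivAt.comp_hasDerivAt x
    ((hasDerivAt_const x t).prodMk (hasDerivAt_id' x))

theorem hasDerivAt_slice_left {n : WithTop ℕ∞} (hf : ContDiff ℝ n (Function.uncurry f))
    (hn : n ≠ 0) (t x : ℝ) :
    HasDerivAt (fun s => f s x) (fderiv ℝ (Function.uncurry f) (t, x) (1, 0)) t := by
  have h : HasDerivAt (fun s : ℝ => (s, x)) (1, 0) t :=
    (hasDerivAt_id' t).prodMk (hasDerivAt_const t x)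
  exact ((hf.differentiable hn) (t, x)).hasFDerivAt.comp_hasDerivAt t h

theorem uncurry_pdx {n : WithTop ℕ∞} (hf : ContDiff ℝ n (Function.uncurry f)) (hn : n ≠ 0) :
    Function.uncurry (pdx f) = fun p => fderiv ℝ (Function.uncurry f) p (0, 1) := by
  ext ⟨t, x⟩
  exact (hasDerivAt_slice_right hf hn t x).deriv

theorem uncurry_pdt {n : WithTop ℕ∞} (hf : ContDiff ℝ n (Function.uncurry f)) (hn : n ≠ 0) :
    Function.uncurry (pdt f) = fun p => fderiv ℝ (Function.uncurry f) p (1, 0) := by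
  ext ⟨t, x⟩
  exact (hasDerivAt_slice_left hf hn t x).deriv

theorem hasDerivAt_pdx {n : WithTop ℕ∞} (hf : ContDiff ℝ n (Function.uncurry f)) (hn : n ≠ 0)
    (t x : ℝ) : HasDerivAt (fun y => f t y) (pdx f t x) x :=
  (hasDerivAt_slice_right hf hn t x).differentiableAt.hasDerivAt

theorem hasDerivAt_pdt {n : WithTop ℕ∞} (hf : ContDiff ℝ n (Function.uncurry f)) (hn : n ≠ 0)
    (t x : ℝ) : HasDerivAt (fun s => f s x) (pdt f t x) t :=
  (hasDerivAt_slice_left hf hn t x).differentiableAt.hasDerivAt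

theorem contDiff_pdx (hf : ContDiff ℝ (⊤ : ℕ∞) (Function.uncurry f)) :
    ContDiff ℝ (⊤ : ℕ∞) (Function.uncurry (pdx f)) := by
  rw [uncurry_pdx hf (by simp)]
  exact (hf.fderiv_right (by simp)).clm_apply contDiff_const

theorem contDiff_pdt (hf : ContDiff ℝ (⊤ : ℕ∞) (Function.uncurry f)) :
    ContDiff ℝ (⊤ : ℕ∞) (Function.uncurry (pdt f)) := by
  rw [uncurry_pdt hf (by simp)]
  exact (hf.fderiv_right (by simp)).clm_apply contDiff_const

/-- Equality of mixed partial derivatives. -/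
theorem pdt_pdx_comm (hf : ContDiff ℝ (⊤ : ℕ∞) (Function.uncurry f)) (t x : ℝ) :
    pdt (pdx f) t x = pdx (pdt f) t x := by
  have hd : DifferentiableAt ℝ (fderiv ℝ (Function.uncurry f)) (t, x) :=
    (hf.fderiv_right (m := (⊤ : ℕ∞)) (by simp)).differentiable (by simp) (t, x)
  have hsymm : IsSymmSndFDerivAt ℝ (Function.uncurry f) (t, x) :=
    hf.contDiffAt.isSymmSndFDerivAt (by
      rw [minSmoothness_of_isRCLikeNormedField]
      exact WithTop.coe_le_coe.2 (le_top : (2 : ℕ∞) ≤ ⊤))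
  have hL := congrFun (uncurry_pdt (contDiff_pdx hf) (by simp)) (t, x)
  have hR := congrFun (uncurry_pdx (contDiff_pdt hf) (by simp)) (t, x)
  rw [uncurry_pdx hf (by simp)] at hL
  rw [uncurry_pdt hf (by simp)] at hR
  simp only [Function.uncurry_apply_pair] at hL hR
  rw [hL, hR, fderiv_clm_apply hd (by fun_prop), fderiv_clm_apply hd (by fun_prop)]
  simpa using hsymm.eq (1, 0) (0, 1)

end PartialDerivatives

/-- **The Miura identity.** For smooth `v = v(t,x)` and `u = B(v) = v_x + v²`, one has
`u_t - 6 u u_x + u_{xxx} = ∂ₓ(mKdV(v)) + 2 v · mKdV(v)` identically on `ℝ²`, where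
`mKdV(v) = v_t - 6 v² v_x + v_{xxx}`. In particular, if `v` is a classical solution of mKdV,
then `u` is a classical solution of KdV. -/
theorem miura_identity (v : ℝ → ℝ → ℝ) (hv : ContDiff ℝ (⊤ : ℕ∞) (Function.uncurry v)) :
    (∀ t x : ℝ,
      pdt (fun t x => pdx v t x + v t x ^ 2) t x
        - 6 * (pdx v t x + v t x ^ 2) * pdx (fun t x => pdx v t x + v t x ^ 2) t x
        + pdx (pdx (pdx (fun t x => pdx v t x + v t x ^ 2))) t x
      = pdx (fun t x => pdt v t x - 6 * v t x ^ 2 * pdx v t x + pdx (pdx (pdx v)) t x) t x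
        + 2 * v t x * (pdt v t x - 6 * v t x ^ 2 * pdx v t x + pdx (pdx (pdx v)) t x)) ∧
    ((∀ t x : ℝ, pdt v t x - 6 * v t x ^ 2 * pdx v t x + pdx (pdx (pdx v)) t x = 0) →
      ∀ t x : ℝ,
        pdt (fun t x => pdx v t x + v t x ^ 2) t x
          - 6 * (pdx v t x + v t x ^ 2) * pdx (fun t x => pdx v t x + v t x ^ 2) t x
          + pdx (pdx (pdx (fun t x => pdx v t x + v t x ^ 2))) t x = 0) := by
  have hx {f : ℝ → ℝ → ℝ} (hf : ContDiff ℝ (⊤ : ℕ∞) (Function.uncurry f)) (t x : ℝ) :=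
    hasDerivAt_pdx hf (by simp) t x
  have hv1 := contDiff_pdx hv
  have hv2 := contDiff_pdx hv1
  have hv3 := contDiff_pdx hv2
  have ux : pdx (fun t x => pdx v t x + v t x ^ 2) =
      fun t x => pdx (pdx v) t x + 2 * v t x * pdx v t x := by
    ext t x
    refine (((hx hv1 t x).add ((hx hv t x).pow 2)).congr_deriv ?_).deriv
    simp
  have uxx : pdx (fun t x => pdx (pdx v) t x + 2 * v t x * pdx v t x) =
      fun t x => pdx (pdx (pdx v)) t x + 2 * pdx v t x ^ 2 + 2 * v t x * pdx (pdx v) t x := by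
    ext t x
    refine (((hx hv2 t x).add (((hx hv t x).const_mul 2).mul (hx hv1 t x))).congr_deriv ?_).deriv
    ring
  have uxxx (t x : ℝ) : pdx (fun t x => pdx (pdx (pdx v)) t x + 2 * pdx v t x ^ 2
        + 2 * v t x * pdx (pdx v) t x) t x =
      pdx (pdx (pdx (pdx v))) t x + 6 * pdx v t x * pdx (pdx v) t x
        + 2 * v t x * pdx (pdx (pdx v)) t x := by
    refine ((((hx hv3 t x).add (((hx hv1 t x).pow 2).const_mul 2)).add
      (((hx hv t x).const_mul 2).mul (hx hv2 t x))).congr_deriv ?_).deriv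
    push_cast
    ring
  have ut (t x : ℝ) : pdt (fun t x => pdx v t x + v t x ^ 2) t x =
      pdx (pdt v) t x + 2 * v t x * pdt v t x := by
    rw [← pdt_pdx_comm hv]
    refine (((hasDerivAt_pdt hv1 (by simp) t x).add
      ((hasDerivAt_pdt hv (by simp) t x).pow 2)).congr_deriv ?_).deriv
    simp
  have mx (t x : ℝ) :
      pdx (fun t x => pdt v t x - 6 * v t x ^ 2 * pdx v t x + pdx (pdx (pdx v)) t x) t x =
      pdx (pdt v) t x - (12 * v t x * pdx v t x ^ 2 + 6 * v t x ^ 2 * pdx (pdx v) t x)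
        + pdx (pdx (pdx (pdx v))) t x := by
    refine ((((hx (contDiff_pdt hv) t x).sub
      ((((hx hv t x).pow 2).const_mul 6).mul (hx hv1 t x))).add (hx hv3 t x)).congr_deriv ?_).deriv
    simp only [Pi.pow_apply]
    push_cast
    ring
  have key (t x : ℝ) :
      pdt (fun t x => pdx v t x + v t x ^ 2) t x
        - 6 * (pdx v t x + v t x ^ 2) * pdx (fun t x => pdx v t x + v t x ^ 2) t x
        + pdx (pdx (pdx (fun t x => pdx v t x + v t x ^ 2))) t x
      = pdx (fun t x => pdt v t x - 6 * v t x ^ 2 * pdx v t x + pdx (pdx (pdx v)) t x) t x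
        + 2 * v t x * (pdt v t x - 6 * v t x ^ 2 * pdx v t x + pdx (pdx (pdx v)) t x) := by
    rw [ux, uxx, uxxx, ut, mx]
    ring
  refine ⟨key, fun h t x => ?_⟩
  rw [key]
  simp only [h]
  simp [pdx]
end

section
/- Let r ∈ C_c^∞(ℝ; ℝ) and set q = r' + r² (a smooth, compactly supported function). If y : ℝ → ℝ is twice continuously differentiable with y(x) > 0 for all x, y(0) = 1, and −y''(x) + q(x) y(x) = 0 for all x ∈ ℝ, then y(x) = exp(∫₀ˣ r(s) ds) for all x. In other words, for q in the image of the Miura map restricted to C_c^∞(ℝ), the normalized positive solution of L_q y = 0 is unique (q belongs to the set E₁ of potentials whose Miura preimage is a single point). -/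
open MeasureTheory Filter Set intervalIntegral

/-- A function on the line whose derivative is bounded below by a positive constant is not
positive everywhere. -/
lemma exists_nonpos_of_le_hasDerivAt {u u' : ℝ → ℝ} {c : ℝ} (hc : 0 < c)
    (hu : ∀ x, HasDerivAt u (u' x) x) (hle : ∀ x, c ≤ u' x) : ∃ x, u x ≤ 0 := by
  have hv : ∀ x, HasDerivAt (fun x => u x - c * x) (u' x - c * 1) x := fun x =>
    (hu x).sub ((hasDerivAt_id x).const_mul c)
  have hmono : Monotone (fun x => u x - c * x) :=
    monotone_of_deriv_nonneg (fun x => (hv x).differentiableAt) fun x => by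
      rw [(hv x).deriv]
      linarith [hle x]
  refine ⟨-(|u 0| / c), ?_⟩
  have h := hmono (show -(|u 0| / c) ≤ 0 by
    have : 0 ≤ |u 0| / c := by positivity
    linarith)
  have hcancel : c * (|u 0| / c) = |u 0| := by field_simp
  simp only [mul_neg, mul_zero, hcancel] at h
  linarith [le_abs_self (u 0)]

/-- A positive function on the line whose derivative is a constant multiple of a function bounded
below by a positive constant has zero derivative. -/
lemma eq_zero_of_pos_of_hasDerivAt_const_mul {u w : ℝ → ℝ} {C m : ℝ} (hm : 0 < m)
    (hw : ∀ x, m ≤ w x) (hpos : ∀ x, 0 < u x) (hu : ∀ x, HasDerivAt u (C * w x) x) : C = 0 := by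
  rcases lt_trichotomy C 0 with hC | hC | hC
  · have hneg : ∀ x, HasDerivAt (fun x => u (-x)) (C * w (-x) * -1) x := fun x =>
      (hu (-x)).comp x (hasDerivAt_neg x)
    obtain ⟨x, hx⟩ := exists_nonpos_of_le_hasDerivAt (mul_pos (neg_pos.2 hC) hm) hneg fun x => by
      nlinarith [hw (-x)]
    exact absurd hx (hpos (-x)).not_ge
  · exact hC
  · obtain ⟨x, hx⟩ := exists_nonpos_of_le_hasDerivAt (mul_pos hC hm) hu fun x =>
      mul_le_mul_of_nonneg_left (hw x) hC.le
    exact absurd hx (hpos x).not_ge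

/-- The primitive of an integrable function is bounded by its `L¹` norm. -/
lemma abs_intervalIntegral_le_integral_abs {r : ℝ → ℝ} (hr : Integrable r) (a b : ℝ) :
    |∫ s in a..b, r s| ≤ ∫ s, |r s| :=
  (norm_integral_le_integral_norm_uIoc (f := r)).trans
    (setIntegral_le_integral hr.norm (Eventually.of_forall fun _ => norm_nonneg _))

/-- **Uniqueness of the normalized positive solution for compactly supported Miura
potentials.** Let `r ∈ C_c^∞(ℝ)` and `q = r' + r²`. If `y` is a `C²` function with `y > 0`,
`y 0 = 1`, and `-y'' + q y = 0` on `ℝ`, then `y x = exp(∫₀ˣ r)`; i.e. `q ∈ E₁`, the Miura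
preimage of `q` consists of a single point. -/
theorem unique_positive_solution_of_compactly_supported
    (r : ℝ → ℝ) (hr : ContDiff ℝ (⊤ : ℕ∞) r) (hrc : HasCompactSupport r)
    (q : ℝ → ℝ) (hq : ∀ x : ℝ, q x = deriv r x + r x ^ 2)
    (y : ℝ → ℝ) (hy : ContDiff ℝ 2 y) (hypos : ∀ x : ℝ, 0 < y x) (hy0 : y 0 = 1)
    (hsol : ∀ x : ℝ, -(deriv (deriv y) x) + q x * y x = 0) :
    ∀ x : ℝ, y x = Real.exp (∫ s in (0:ℝ)..x, r s) := by
  have hr' : ∀ x, HasDerivAt r (deriv r x) x := fun x =>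
    (hr.differentiable (by simp) x).hasDerivAt
  have hy' : ∀ x, HasDerivAt y (deriv y x) x := fun x =>
    (hy.differentiable (by simp) x).hasDerivAt
  have hy'' : ∀ x, HasDerivAt (deriv y) (deriv (deriv y) x) x := fun x =>
    (hy.differentiable_deriv_two x).hasDerivAt
  set I : ℝ → ℝ := fun x => ∫ s in (0:ℝ)..x, r s with hI
  have hI' : ∀ x, HasDerivAt I (r x) x := fun x =>
    hr.continuous.integral_hasStrictDerivAt 0 x |>.hasDerivAt
  have hI0 : I 0 = 0 := by simp [hI]
  set M : ℝ := ∫ s, |r s|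
  have hIM : ∀ x, |I x| ≤ M := fun x =>
    abs_intervalIntegral_le_integral_abs (hr.continuous.integrable_of_hasCompactSupport hrc) 0 x
  -- The Wronskian of `y` and `exp I` is constant.
  have hW' : ∀ x, HasDerivAt (fun x => (deriv y x - r x * y x) * Real.exp (I x)) 0 x := fun x => by
    refine (((hy'' x).sub ((hr' x).mul (hy' x))).mul (hI' x).exp).congr_deriv ?_
    have h2 : deriv (deriv y) x = (deriv r x + r x ^ 2) * y x := by
      rw [← hq]
      linarith [hsol x]
    simp only [Pi.sub_apply, Pi.mul_apply]
    rw [h2]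
    ring
  obtain ⟨C, hC⟩ : ∃ C, ∀ x, (deriv y x - r x * y x) * Real.exp (I x) = C :=
    ⟨_, fun x => is_const_of_deriv_eq_zero (fun x => (hW' x).differentiableAt)
      (fun x => (hW' x).deriv) x 0⟩
  have hu : ∀ x, HasDerivAt (fun x => y x * Real.exp (-I x)) (C * Real.exp (-(2 * I x))) x :=
    fun x => by
      refine ((hy' x).mul (hI' x).neg.exp).congr_deriv ?_
      have hexp : Real.exp (-I x) = Real.exp (I x) * Real.exp (-(2 * I x)) := by
        rw [← Real.exp_add]
        ring_nf
      rw [← hC x]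
      simp only [Pi.neg_apply]
      rw [hexp]
      ring
  have hC0 : C = 0 := eq_zero_of_pos_of_hasDerivAt_const_mul (Real.exp_pos (-(2 * M)))
    (fun x => Real.exp_le_exp.2 (by linarith [le_abs_self (I x), hIM x]))
    (fun x => mul_pos (hypos x) (Real.exp_pos _)) hu
  intro x
  have hconst := is_const_of_deriv_eq_zero (fun x => (hu x).differentiableAt)
    (fun x => by rw [(hu x).deriv, hC0, zero_mul]) x 0
  simp only [hy0, hI0, neg_zero, Real.exp_zero, mul_one, Real.exp_neg] at hconst
  exact eq_of_mul_inv_eq_one hconst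
end
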